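/- arXiv:1202.4148 — 4 statements merged into one kernel-verified Lean document; each statement's English description precedes it below -/
import Mathlib

section
/- Let K be a group and v ∈ K an element such that the centralizer of v in K equals the centralizer of v² in K. If u, k ∈ K satisfy u² = k·v²·k⁻¹, then u is conjugate to v in K if and only if u = k·v·k⁻¹. -/
/-- If the centralizer of `v` equals the centralizer of `v ^ 2` and `u ^ 2 = k·v²·k⁻¹`,
then `u` is conjugate to `v` iff `u = k·v·k⁻¹`. -/
theorem stmt_4 (K : Type*) [Group K] (v : K)
    (hZ : Subgroup.centralizer {v} = Subgroup.centralizer {v ^ 2})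
    (u k : K) (hk : u ^ 2 = k * v ^ 2 * k⁻¹) :
    (∃ g : K, g * v * g⁻¹ = u) ↔ u = k * v * k⁻¹ := by
  constructor
  · rintro ⟨g, rfl⟩
    rw [conj_pow] at hk
    have hmem : k⁻¹ * g ∈ Subgroup.centralizer {v ^ 2} := by
      rw [Subgroup.mem_centralizer_singleton_iff]
      calc k⁻¹ * g * v ^ 2 = k⁻¹ * (g * v ^ 2 * g⁻¹) * g := by group
        _ = k⁻¹ * (k * v ^ 2 * k⁻¹) * g := by rw [hk]
        _ = v ^ 2 * (k⁻¹ * g) := by group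
    rw [← hZ, Subgroup.mem_centralizer_singleton_iff] at hmem
    calc g * v * g⁻¹ = k * (k⁻¹ * g * v) * g⁻¹ := by group
      _ = k * (v * (k⁻¹ * g)) * g⁻¹ := by rw [hmem]
      _ = k * v * k⁻¹ := by group
  · rintro rfl
    exact ⟨k, rfl⟩
end

section
/- Let G be a group, H a subgroup of index 2, and v ∈ G \ H an element of infinite order such that Z_G(v²) ∩ H is an infinite cyclic group. Then Z_G(v) = Z_G(v²). -/
/-- If a power `t ^ k` with `k ≠ 0` of an element `t` of infinite order commutes with `v`, and
`v` conjugates `t` to a power of itself, then `v` commutes with `t`. -/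
lemma commute_of_conj_eq_zpow {G : Type*} [Group G] {v t : G} (ht : ¬ IsOfFinOrder t)
    {k m : ℤ} (hk : k ≠ 0) (hcomm : Commute v (t ^ k)) (hconj : t ^ m = v * t * v⁻¹) :
    Commute v t := by
  have hinj := injective_zpow_iff_not_isOfFinOrder.mpr ht
  have hpow : t ^ (m * k) = t ^ k := by
    rw [zpow_mul, hconj, conj_zpow, hcomm.eq, mul_inv_cancel_right]
  have hm : m = 1 := by
    have hmk : m * k = k := hinj hpow
    exact (mul_eq_right₀ hk).mp hmk
  rw [hm, zpow_one] at hconj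
  exact (eq_mul_inv_iff_mul_eq.mp hconj).symm

/-- If `H` has index 2 in `G`, `v ∉ H` has infinite order and `Z_G(v²) ∩ H` is infinite
cyclic, then `Z_G(v) = Z_G(v²)`. -/
theorem stmt_6 (G : Type*) [Group G] (H : Subgroup G) (hH : H.index = 2)
    (v : G) (hv : v ∉ H) (hord : ¬ IsOfFinOrder v)
    (t : G) (ht : ¬ IsOfFinOrder t)
    (hZ : Subgroup.centralizer {v ^ 2} ⊓ H = Subgroup.zpowers t) :
    Subgroup.centralizer {v} = Subgroup.centralizer {v ^ 2} := by
  have hmem (x : G) : (Commute x (v ^ 2) ∧ x ∈ H) ↔ x ∈ Subgroup.zpowers t := by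
    rw [← hZ, Subgroup.mem_inf, Subgroup.mem_centralizer_singleton_iff]
    rfl
  have hvv : Commute v (v ^ 2) := Commute.self_pow v 2
  obtain ⟨k, hk : t ^ k = v ^ 2⟩ :=
    (hmem (v ^ 2)).mp ⟨Commute.refl _, Subgroup.sq_mem_of_index_two hH v⟩
  have hk0 : k ≠ 0 := by
    rintro rfl
    exact hord (isOfFinOrder_iff_pow_eq_one.mpr ⟨2, two_pos, by rw [← hk, zpow_zero]⟩)
  have htH := (hmem t).mpr (Subgroup.mem_zpowers t)
  have hnormal := Subgroup.normal_of_index_eq_two hH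
  obtain ⟨m, hm : t ^ m = v * t * v⁻¹⟩ := (hmem (v * t * v⁻¹)).mp
    ⟨(hvv.mul_left htH.1).mul_left hvv.inv_left, hnormal.conj_mem t htH.2 v⟩
  have hvt : Commute v t := commute_of_conj_eq_zpow ht hk0 (hk ▸ hvv) hm
  have hcyc {x : G} (hx : Commute x (v ^ 2)) (hxH : x ∈ H) : Commute x v := by
    obtain ⟨j, rfl⟩ := (hmem x).mp ⟨hx, hxH⟩
    exact (hvt.zpow_right j).symm
  ext x
  rw [Subgroup.mem_centralizer_singleton_iff, Subgroup.mem_centralizer_singleton_iff]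
  refine ⟨fun hx ↦ Commute.pow_right hx 2, fun hx ↦ ?_⟩
  by_cases hxH : x ∈ H
  · exact hcyc hx hxH
  · have hxv : x * v ∈ H := by
      simp [Subgroup.mul_mem_iff_of_index_two hH, hxH, hv]
    have hcomm := (hcyc (Commute.mul_left hx hvv) hxv).mul_left (Commute.refl v).inv_left
    rwa [mul_inv_cancel_right] at hcomm
end

section
/- Let G be a group and K a subgroup of G, and let Γ = G *_K G be the amalgamated free product of two copies of G over K, i.e., the pushout in the category of groups of the two copies of the inclusion K ↪ G, with canonical homomorphisms ι₁, ι₂ : G → Γ. Then for every g ∈ G, the elements ι₁(g) and ι₂(g) are conjugate in Γ if and only if g is conjugate in G to some element of K. -/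
open Classical in
/-- Adding a point to `X × ℕ` by shifting the fibre over the base point `x₀`. -/
noncomputable def optionProdNatEquiv {X : Type*} (x₀ : X) : Option (X × ℕ) ≃ X × ℕ where
  toFun
    | none => (x₀, 0)
    | some (x, n) => if x = x₀ then (x₀, n + 1) else (x, n)
  invFun
    | (x, 0) => if x = x₀ then none else some (x, 0)
    | (x, n + 1) => if x = x₀ then some (x₀, n) else some (x, n + 1)
  left_inv := by
    rintro (_ | ⟨x, _ | n⟩)
    · simp
    all_goals by_cases h : x = x₀ <;> simp [h]
  right_inv := by
    rintro ⟨x, _ | n⟩ <;> by_cases h : x = x₀ <;> simp [h]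

/-- The permutation action on `X × ℕ` through the first factor. -/
def prodNatPermHom (G X : Type*) [Group G] [MulAction G X] : G →* Equiv.Perm (X × ℕ) :=
  MonoidHom.mk' (fun a => (MulAction.toPerm a).prodCongr (Equiv.refl ℕ)) fun a b => by
    ext ⟨x, n⟩ <;> simp [mul_smul]

/-- The action on `X × ℕ` through the first factor, with a fixed point inserted by
transport along `optionProdNatEquiv`. -/
noncomputable def pointedProdNatPermHom (G : Type*) {X : Type*} [Group G] [MulAction G X]
    (x₀ : X) : G →* Equiv.Perm (X × ℕ) :=
  MonoidHom.mk'
    (fun a => (optionProdNatEquiv x₀).permCongr (prodNatPermHom G X a).optionCongr) fun a b => by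
    ext1 y
    obtain ⟨z, rfl⟩ := (optionProdNatEquiv x₀).surjective y
    cases z <;> simp [Equiv.permCongr_apply]

theorem prodNatPermHom_apply {G X : Type*} [Group G] [MulAction G X] (a : G) (p : X × ℕ) :
    prodNatPermHom G X a p = (a • p.1, p.2) := rfl

theorem pointedProdNatPermHom_apply {G X : Type*} [Group G] [MulAction G X] (x₀ : X) (a : G)
    (z : Option (X × ℕ)) :
    pointedProdNatPermHom G x₀ a (optionProdNatEquiv x₀ z) =
      optionProdNatEquiv x₀ (z.map (prodNatPermHom G X a)) := by
  simp [pointedProdNatPermHom, Equiv.permCongr_apply]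

/-- The two actions agree on the stabilizer of the base point. -/
theorem pointedProdNatPermHom_eq_of_smul_eq {G X : Type*} [Group G] [MulAction G X] {x₀ : X}
    {a : G} (ha : a • x₀ = x₀) : pointedProdNatPermHom G x₀ a = prodNatPermHom G X a := by
  ext1 y
  obtain ⟨z, rfl⟩ := (optionProdNatEquiv x₀).surjective y
  rw [pointedProdNatPermHom_apply]
  rcases z with _ | ⟨x, n⟩
  · simp [optionProdNatEquiv, prodNatPermHom_apply, ha]
  · have hx : a • x = x₀ ↔ x = x₀ := by
      rw [← smul_left_cancel_iff a (x := x), ha]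
    by_cases h : x = x₀ <;> simp [optionProdNatEquiv, prodNatPermHom_apply, hx, h, ha]

/-- In the amalgamated product `Γ = G *_K G` of two copies of a group `G` over a
subgroup `K` (the pushout of the two copies of the inclusion `K ↪ G`), the images of
`g ∈ G` under the two canonical homomorphisms are conjugate in `Γ` iff `g` is
conjugate in `G` to an element of `K`. -/
theorem stmt_14 (G : Type*) [Group G] (K : Subgroup G) (g : G) :
    IsConj
        ((Monoid.PushoutI.of (G := fun _ : Bool => G) (φ := fun _ : Bool => K.subtype) true) g)
        ((Monoid.PushoutI.of (φ := fun _ : Bool => K.subtype) false) g) ↔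
      ∃ k ∈ K, IsConj g k := by
  constructor
  · intro h
    let x₀ : G ⧸ K := ((1 : G) : G ⧸ K)
    have hK (k : K) : (k : G) • x₀ = x₀ := by
      change (((k : G) * 1 : G) : G ⧸ K) = ((1 : G) : G ⧸ K)
      rw [QuotientGroup.eq]
      simp
    let F : Monoid.PushoutI (G := fun _ : Bool => G) (fun _ : Bool => K.subtype) →*
        Equiv.Perm ((G ⧸ K) × ℕ) :=
      Monoid.PushoutI.lift
        (fun b => bif b then pointedProdNatPermHom G x₀ else prodNatPermHom G (G ⧸ K))
        ((prodNatPermHom G (G ⧸ K)).comp K.subtype) (by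
          rintro (_ | _)
          · rfl
          · ext1 k
            exact pointedProdNatPermHom_eq_of_smul_eq (hK k))
    have hF := F.map_isConj h
    simp only [F, Monoid.PushoutI.lift_of, cond_true, cond_false] at hF
    obtain ⟨c, hc⟩ := isConj_iff.mp hF
    have hfix : pointedProdNatPermHom G x₀ g (optionProdNatEquiv x₀ none) =
        optionProdNatEquiv x₀ none := pointedProdNatPermHom_apply x₀ g none
    obtain ⟨⟨q, n⟩, hq⟩ : ∃ p, prodNatPermHom G (G ⧸ K) g p = p :=
      ⟨c (optionProdNatEquiv x₀ none), by simp [← hc, hfix]⟩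
    obtain ⟨a, rfl⟩ := QuotientGroup.mk_surjective q
    have ha : ((a : G) : G ⧸ K) = ((g * a : G) : G ⧸ K) := (congrArg Prod.fst hq).symm
    rw [QuotientGroup.eq] at ha
    exact ⟨_, ha, isConj_iff.mpr ⟨a⁻¹, by group⟩⟩
  · rintro ⟨k, hk, h⟩
    have hof : Monoid.PushoutI.of (G := fun _ : Bool => G) (φ := fun _ : Bool => K.subtype) true k =
        Monoid.PushoutI.of (φ := fun _ : Bool => K.subtype) false k :=
      (Monoid.PushoutI.of_apply_eq_base (fun _ : Bool => K.subtype) true ⟨k, hk⟩).trans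
        (Monoid.PushoutI.of_apply_eq_base (fun _ : Bool => K.subtype) false ⟨k, hk⟩).symm
    have h₁ := (Monoid.PushoutI.of (G := fun _ : Bool => G)
      (φ := fun _ : Bool => K.subtype) true).map_isConj h
    rw [hof] at h₁
    exact h₁.trans ((Monoid.PushoutI.of (G := fun _ : Bool => G)
      (φ := fun _ : Bool => K.subtype) false).map_isConj h.symm)
end

section
/- Let A, K, B be groups with injective homomorphisms A → K and A → B, where B is abelian, and let Γ = K *_A B be the amalgamated free product (the pushout of these two homomorphisms in the category of groups), with canonical injections ι₁ : K → Γ and ι₂ : B → Γ. If u, v ∈ B are each not conjugate in B to any element of the image of A in B, then ι₂(u) and ι₂(v) are conjugate in Γ if and only if u = v. -/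
universe u

/-- The two-element family of groups `⟨G₁, G₂⟩`, indexed by `Bool`. -/
def Gfam (G₁ G₂ : Type u) : Bool → Type u := fun b => bif b then G₁ else G₂

instance (G₁ G₂ : Type u) [Group G₁] [Group G₂] (b : Bool) : Group (Gfam G₁ G₂ b) :=
  match b with
  | true => ‹Group G₁›
  | false => ‹Group G₂›

/-- The pair of homomorphisms `⟨f₁, f₂⟩` out of `A`, as a `Bool`-indexed family. -/
def phiFam {A G₁ G₂ : Type u} [Group A] [Group G₁] [Group G₂]
    (f₁ : A →* G₁) (f₂ : A →* G₂) : ∀ b : Bool, A →* Gfam G₁ G₂ b :=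
  fun b => match b with
  | true => f₁
  | false => f₂

namespace Monoid.PushoutI

variable {ι : Type*} {G : ι → Type*} {H : Type*} [∀ i, Group (G i)] [Group H]
  {φ : ∀ i, H →* G i}

/-- `IsReducedProd i j x` says that `x` is a nonempty product of letters outside the base group,
with adjacent letters in different factors, the first letter in `G i` and the last in `G j`. -/
inductive IsReducedProd : ι → ι → PushoutI φ → Prop
  | of {i : ι} {g : G i} (hg : g ∉ (φ i).range) : IsReducedProd i i (of i g)
  | cons {i j k : ι} {g : G i} {x : PushoutI φ} (hg : g ∉ (φ i).range) (hij : i ≠ j)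
      (hx : IsReducedProd j k x) : IsReducedProd i k (PushoutI.of i g * x)

namespace IsReducedProd

variable {i j k l : ι} {x y : PushoutI φ}

theorem mul (hx : IsReducedProd i j x) (hjk : j ≠ k) (hy : IsReducedProd k l y) :
    IsReducedProd i l (x * y) := by
  induction hx with
  | of hg => exact .cons hg hjk hy
  | cons hg hij _ ih => rw [mul_assoc]; exact .cons hg hij (ih hjk)

theorem inv (hx : IsReducedProd i j x) : IsReducedProd j i x⁻¹ := by
  induction hx with
  | of hg => rw [← map_inv]; exact .of (by rwa [inv_mem_iff])
  | cons hg hij _ ih =>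
    rw [mul_inv_rev, ← map_inv]
    exact ih.mul hij.symm (.of (by rwa [inv_mem_iff]))

theorem base_mul (h : H) (hx : IsReducedProd i j x) : IsReducedProd i j (base φ h * x) := by
  cases hx with
  | of hg =>
    rw [← of_apply_eq_base φ i, ← map_mul]
    exact .of (by rwa [Subgroup.mul_mem_cancel_left _ (MonoidHom.mem_range.2 ⟨h, rfl⟩)])
  | cons hg hij hy =>
    rw [← of_apply_eq_base φ i, ← mul_assoc, ← map_mul]
    exact .cons (by rwa [Subgroup.mul_mem_cancel_left _ (MonoidHom.mem_range.2 ⟨h, rfl⟩)]) hij hy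

theorem exists_normalWord (d : NormalWord.Transversal φ) (hx : IsReducedProd i j x) :
    ∃ w : NormalWord d, w.prod = x ∧ w.fstIdx = some i := by
  induction hx with
  | @of i g hg =>
    exact ⟨.cons g .empty (by simp [CoprodI.Word.fstIdx]) hg, by simp,
      by simp [CoprodI.Word.fstIdx]⟩
  | @cons i j k g x hg hij _ ih =>
    obtain ⟨w, rfl, hw⟩ := ih
    exact ⟨.cons g w (by simpa [hw] using hij.symm) hg, by simp,
      by simp [CoprodI.Word.fstIdx]⟩

theorem ne_one (hφ : ∀ i, Function.Injective (φ i)) (hx : IsReducedProd i j x) : x ≠ 1 := by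
  rintro rfl
  obtain ⟨d⟩ := NormalWord.transversal_nonempty φ hφ
  obtain ⟨w, hw, hi⟩ := hx.exists_normalWord d
  obtain rfl : w = .empty := NormalWord.prod_injective (by simpa using hw)
  simp [CoprodI.Word.fstIdx] at hi

end IsReducedProd

theorem mem_range_base_or_isReducedProd (hφ : ∀ i, Function.Injective (φ i)) (x : PushoutI φ) :
    x ∈ (base φ).range ∨ ∃ i j, IsReducedProd i j x := by
  classical
  obtain ⟨d⟩ := NormalWord.transversal_nonempty φ hφ
  obtain ⟨w, rfl⟩ := (NormalWord.equiv (d := d)).symm.surjective x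
  change w.prod ∈ _ ∨ ∃ i j, IsReducedProd i j w.prod
  suffices (w.prod ∈ (base φ).range) ∨ ∃ i j, w.fstIdx = some i ∧ IsReducedProd i j w.prod from
    this.imp_right fun ⟨i, j, _, h⟩ => ⟨i, j, h⟩
  induction w using NormalWord.consRecOn with
  | empty => exact .inl (by simp)
  | cons i g w hmw _ hgr _ ih =>
    right
    rw [NormalWord.prod_cons]
    obtain ⟨h, hh⟩ | ⟨j, k, hj, hw⟩ := ih
    · refine ⟨i, i, by simp [CoprodI.Word.fstIdx], ?_⟩
      rw [← hh, ← of_apply_eq_base φ i, ← map_mul]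
      exact .of (by rwa [Subgroup.mul_mem_cancel_right _ (MonoidHom.mem_range.2 ⟨h, rfl⟩)])
    · refine ⟨i, k, by simp [CoprodI.Word.fstIdx], .cons hgr ?_ hw⟩
      rintro rfl
      exact hmw hj
  | base h w _ ih =>
    rw [NormalWord.prod_smul, NormalWord.base_smul_eq_smul]
    obtain hw | ⟨j, k, hj, hw⟩ := ih
    · exact .inl (mul_mem ⟨h, rfl⟩ hw)
    · exact .inr ⟨j, k, hj, hw.base_mul h⟩

variable {i j k : ι} {x : PushoutI φ} {u v : G k}

theorem IsReducedProd.not_semiconjBy_of_ne_of_ne (hφ : ∀ i, Function.Injective (φ i))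
    (hx : IsReducedProd i j x) (hik : i ≠ k) (hjk : j ≠ k)
    (hu : u ∉ (φ k).range) (hv : v ∉ (φ k).range) :
    ¬ SemiconjBy x (PushoutI.of k u) (PushoutI.of k v) := fun h =>
  (((hx.mul hjk (.of hu)).mul hjk.symm hx.inv).mul hik (.of (inv_mem_iff.not.2 hv))).ne_one hφ
    (by rw [h.eq, map_inv]; group)

theorem IsReducedProd.not_semiconjBy_of_ne (hφ : ∀ i, Function.Injective (φ i))
    (hx : IsReducedProd i j x) (hjk : j ≠ k)
    (hu : u ∉ (φ k).range) (hv : ∀ a, ¬ IsConj v (φ k a)) :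
    ¬ SemiconjBy x (PushoutI.of k u) (PushoutI.of k v) := by
  have hv_conj (c : G k) : c⁻¹ * v * c ∉ (φ k).range := by
    rintro ⟨a, ha⟩
    exact hv a (isConj_iff.2 ⟨c⁻¹, by simp [ha]⟩)
  by_cases hik : i = k
  · subst hik
    cases hx with
    | of => exact absurd rfl hjk
    | @cons _ l _ b y hb hil hy =>
      refine fun h => hy.not_semiconjBy_of_ne_of_ne hφ hil.symm hjk hu (hv_conj b) ?_
      have hb_inv : SemiconjBy (PushoutI.of (φ := φ) _ b)⁻¹ (PushoutI.of _ v)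
          (PushoutI.of _ (b⁻¹ * v * b)) := by simp [SemiconjBy, mul_assoc]
      simpa using hb_inv.mul_left h
  · exact hx.not_semiconjBy_of_ne_of_ne hφ hik hjk hu (by simpa using hv_conj 1)

/-- Elements of a factor that are not conjugate in it into the base group are conjugate in the
amalgamated product if and only if they are conjugate in the factor. -/
theorem isConj_of_iff (hφ : ∀ i, Function.Injective (φ i))
    (hu : ∀ a, ¬ IsConj u (φ k a)) (hv : ∀ a, ¬ IsConj v (φ k a)) :
    IsConj (of (φ := φ) k u) (of k v) ↔ IsConj u v := by
  refine ⟨fun h => ?_, fun h => (of k).map_isConj h⟩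
  have isConj_of_semiconjBy (c : G k) (hc : SemiconjBy (of (φ := φ) k c) (of k u) (of k v)) :
      IsConj u v := by
    refine isConj_iff.2 ⟨c, mul_inv_eq_of_eq_mul (of_injective hφ k ?_)⟩
    simpa using hc.eq
  have hu_conj (c : G k) : c⁻¹ * u * c ∉ (φ k).range := by
    rintro ⟨a, ha⟩
    exact hu a (isConj_iff.2 ⟨c⁻¹, by simp [ha]⟩)
  obtain ⟨x, hx⟩ := isConj_iff.1 h
  replace hx : SemiconjBy x (of k u) (of k v) := mul_inv_eq_iff_eq_mul.1 hx
  obtain ⟨a, rfl⟩ | ⟨i, j, hr⟩ := mem_range_base_or_isReducedProd hφ x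
  · exact isConj_of_semiconjBy (φ k a) (by rwa [of_apply_eq_base])
  by_cases hjk : j = k
  · subst hjk
    obtain ⟨y, rfl⟩ : ∃ y, x = y⁻¹ := ⟨x⁻¹, by simp⟩
    replace hr := hr.inv
    rw [inv_inv] at hr
    cases hr with
    | @of _ b hb => exact isConj_of_semiconjBy b⁻¹ (by rwa [map_inv])
    | @cons _ l _ b y hb hil hy =>
      refine absurd ?_ (hy.inv.not_semiconjBy_of_ne hφ hil.symm (hu_conj b) hv)
      have hb_conj : SemiconjBy (of (φ := φ) _ b) (of _ (b⁻¹ * u * b)) (of _ u) := by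
        simp [SemiconjBy, mul_assoc]
      simpa using hx.mul_left hb_conj
  · exact absurd hx (hr.not_semiconjBy_of_ne hφ hjk (by simpa using hu_conj 1) hv)

end Monoid.PushoutI

/-- In the amalgamated product `Γ = K *_A B` (pushout of injections `A → K`, `A → B`)
with `B` abelian, two elements `u, v` of `B` that are each not conjugate in `B` into
the image of `A` are conjugate in `Γ` iff they are equal. -/
theorem stmt_16 (A K B : Type u) [Group A] [Group K] [CommGroup B]
    (f₁ : A →* K) (f₂ : A →* B)
    (h₁ : Function.Injective f₁) (h₂ : Function.Injective f₂)
    (u v : B) (hu : ∀ a : A, ¬ IsConj u (f₂ a)) (hv : ∀ a : A, ¬ IsConj v (f₂ a)) :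
    IsConj ((Monoid.PushoutI.of (φ := phiFam f₁ f₂) false) u)
        ((Monoid.PushoutI.of (φ := phiFam f₁ f₂) false) v) ↔ u = v := by
  have hφ : ∀ b, Function.Injective (phiFam f₁ f₂ b) := Bool.rec h₂ h₁
  exact (Monoid.PushoutI.isConj_of_iff hφ hu hv).trans (isConj_iff_eq (α := B))
end
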